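/- Let d ≥ 1 be an integer and p > d+1. There exist η₀, τ₀, M₀ > 0 depending only on p and d such that the following holds for all 0 < τ < τ₀ and all h > 0. Let (E,B) be a one-dimensional set of locally finite perimeter, let A₀ ⊆ B ∩ [0,h), set A₁ := {s ∈ B ∩ [0,h) : min{s − s⁻, s⁺ − s} < η₀}, and let (F, B_F) be a one-dimensional set of locally finite perimeter with B_F = B ∖ (A₀ ∪ A₁). Then ∑_{s ∈ B_F ∩ [0,h)} r_τ(F,s) ≤ ∑_{s ∈ B ∩ [0,h)} r_τ(E,s) + M₀ · #(A₀ ∪ A₁). -/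

import Mathlib

open MeasureTheory Filter
open scoped ENNReal

noncomputable section

/-- The rescaled one-dimensional kernel `K̄_τ(ρ) = |ρ|^{d−1} max(τ^{1/(p−d−1)}, |ρ|)^{−p}`. -/
def Kbar (d : ℕ) (p τ : ℝ) (ρ : ℝ) : ℝ :=
  |ρ| ^ ((d : ℝ) - 1) * (max (τ ^ (1 / (p - d - 1))) |ρ|) ^ (-p)

/-- The indicator function of a set of reals. -/
def ind (E : Set ℝ) : ℝ → ℝ := Set.indicator E fun _ => (1 : ℝ)

/-- `χ_E` is a.e. constant on `I`. -/
def AEConstOn (E : Set ℝ) (I : Set ℝ) : Prop :=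
  ∃ c : ℝ, ∀ᵐ u ∂(volume.restrict I), ind E u = c

/-- The quantity `r_τ(E,s)` with finite neighbours `sm < s < sp`. -/
def rtau (d : ℕ) (p τ : ℝ) (E : Set ℝ) (sm s sp : ℝ) : ℝ :=
  (∫ ρ in Set.Ioo (-1 : ℝ) 1, |ρ| * Kbar d p τ ρ)
  - (∫ u in Set.Ioo sm s, ∫ ρ in Set.Ioi (0 : ℝ), |ind E (u + ρ) - ind E u| * Kbar d p τ ρ)
  - (∫ u in Set.Ioo s sp, ∫ ρ in Set.Iio (0 : ℝ), |ind E (u + ρ) - ind E u| * Kbar d p τ ρ)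

/-- The quantity `r_τ(E,s)` with possibly infinite neighbours `sm < s < sp`. -/
def rtauE (d : ℕ) (p τ : ℝ) (E : Set ℝ) (sm : EReal) (s : ℝ) (sp : EReal) : ℝ :=
  (∫ ρ in Set.Ioo (-1 : ℝ) 1, |ρ| * Kbar d p τ ρ)
  - (∫ u in {u : ℝ | sm < (u : EReal) ∧ u < s},
      ∫ ρ in Set.Ioi (0 : ℝ), |ind E (u + ρ) - ind E u| * Kbar d p τ ρ)
  - (∫ u in {u : ℝ | s < u ∧ (u : EReal) < sp},
      ∫ ρ in Set.Iio (0 : ℝ), |ind E (u + ρ) - ind E u| * Kbar d p τ ρ)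

/-- `(E,B)` is a one-dimensional set of locally finite perimeter: `B` is a closed, locally
finite set of jump points of `χ_E`. -/
def IsOneDPerimeterSet (E B : Set ℝ) : Prop :=
  MeasurableSet E ∧ IsClosed B ∧ (∀ K : Set ℝ, IsCompact K → (B ∩ K).Finite) ∧
  (∀ a b : ℝ, a < b → Set.Ioo a b ∩ B = ∅ → AEConstOn E (Set.Ioo a b)) ∧
  (∀ s ∈ B, ∀ a b : ℝ, a < s → s < b →
    Set.Ioo a s ∩ B = ∅ → Set.Ioo s b ∩ B = ∅ →
    ∀ c₁ c₂ : ℝ,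
      (∀ᵐ u ∂(volume.restrict (Set.Ioo a s)), ind E u = c₁) →
      (∀ᵐ u ∂(volume.restrict (Set.Ioo s b)), ind E u = c₂) →
      c₁ ≠ c₂)

/-- The successor `s⁺` of `s` in `B` (`+∞` if none). -/
def succPt (B : Set ℝ) (s : ℝ) : EReal :=
  sInf ((fun t : ℝ => (t : EReal)) '' {t | t ∈ B ∧ s < t})

/-- The predecessor `s⁻` of `s` in `B` (`−∞` if none). -/
def predPt (B : Set ℝ) (s : ℝ) : EReal :=
  sSup ((fun t : ℝ => (t : EReal)) '' {t | t ∈ B ∧ t < s})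

/-- `r_τ(E,s)` computed with the neighbours of `s` in the boundary `B`. -/
def rPt (d : ℕ) (p τ : ℝ) (E B : Set ℝ) (s : ℝ) : ℝ :=
  rtauE d p τ E (predPt B s) s (succPt B s)

/-- `x^{-q}` for `x : EReal`, with the convention that it vanishes at `x = +∞`. -/
def powNegE (q : ℝ) (x : EReal) : ℝ :=
  if x = ⊤ then 0 else x.toReal ^ (-q)

lemma Kbar_nonneg (d : ℕ) (p τ ρ : ℝ) (hτ : 0 < τ) : 0 ≤ Kbar d p τ ρ := by
  unfold Kbar
  have : 0 ≤ max (τ ^ (1 / (p - d - 1))) |ρ| := le_max_of_le_right (abs_nonneg _)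
  positivity

lemma Kbar_neg (d : ℕ) (p τ ρ : ℝ) : Kbar d p τ (-ρ) = Kbar d p τ ρ := by
  simp [Kbar]

lemma Kbar_meas (d : ℕ) (p τ : ℝ) : Measurable (Kbar d p τ) := by
  unfold Kbar; fun_prop

lemma Kbar_large (d : ℕ) (p τ ρ : ℝ) (hp : (d : ℝ) + 1 < p) (hτ : 0 < τ) (hτ1 : τ < 1)
    (hρ : 1 ≤ ρ) : Kbar d p τ ρ = ρ ^ ((d : ℝ) - 1 - p) := by
  unfold Kbar
  have h1 : τ ^ (1 / (p - d - 1)) ≤ 1 :=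
    Real.rpow_le_one hτ.le hτ1.le (by apply div_nonneg <;> linarith)
  rw [abs_of_nonneg (by linarith), max_eq_right (by linarith), ← Real.rpow_add (by linarith)]
  congr 1

lemma Kbar_small (d : ℕ) (hd : 1 ≤ d) (p τ ρ : ℝ) (hp : (d : ℝ) + 1 < p) (hτ : 0 < τ)
    (hρ : |ρ| ≤ 1) : Kbar d p τ ρ ≤ (τ ^ (1 / (p - d - 1))) ^ (-p) := by
  unfold Kbar
  have hε : 0 < τ ^ (1 / (p - d - 1)) := Real.rpow_pos_of_pos hτ _
  have hd' : (1 : ℝ) ≤ d := by exact_mod_cast hd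
  have h1 : |ρ| ^ ((d : ℝ) - 1) ≤ 1 := Real.rpow_le_one (abs_nonneg _) hρ (by linarith)
  have h2 : (max (τ ^ (1 / (p - d - 1))) |ρ|) ^ (-p) ≤ (τ ^ (1 / (p - d - 1))) ^ (-p) :=
    Real.rpow_le_rpow_of_nonpos hε (le_max_left _ _) (by linarith)
  have h3 : 0 ≤ (max (τ ^ (1 / (p - d - 1))) |ρ|) ^ (-p) := by
    have : 0 ≤ max (τ ^ (1 / (p - d - 1))) |ρ| := le_max_of_le_right (abs_nonneg _)
    positivity
  have h4 : 0 ≤ |ρ| ^ ((d : ℝ) - 1) := by positivity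
  nlinarith

lemma Kbar_int (d : ℕ) (hd : 1 ≤ d) (p τ : ℝ) (hp : (d : ℝ) + 1 < p) (hτ : 0 < τ)
    (hτ1 : τ < 1) : IntegrableOn (Kbar d p τ) (Set.Ioi 0) := by
  have : Set.Ioi (0:ℝ) = Set.Ioc 0 1 ∪ Set.Ioi 1 := by
    rw [Set.Ioc_union_Ioi_eq_Ioi zero_le_one]
  rw [this]
  apply IntegrableOn.union
  · apply Measure.integrableOn_of_bounded (M := (τ ^ (1 / (p - d - 1))) ^ (-p)) (by simp)
      (Kbar_meas d p τ).aestronglyMeasurable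
    refine (ae_restrict_mem measurableSet_Ioc).mono fun ρ hρ => ?_
    rw [Real.norm_of_nonneg (Kbar_nonneg d p τ ρ hτ)]
    exact Kbar_small d hd p τ ρ hp hτ (by rw [abs_of_pos hρ.1]; exact hρ.2)
  · have := integrableOn_Ioi_rpow_of_lt (a := (d : ℝ) - 1 - p) (by linarith) (c := 1) one_pos
    refine this.congr_fun (fun ρ hρ => ?_) measurableSet_Ioi
    exact (Kbar_large d p τ ρ hp hτ hτ1 (le_of_lt hρ)).symm

/-- the `τ`-independent tail constant -/
def J1 (d : ℕ) (p : ℝ) : ℝ≥0∞ := ∫⁻ ρ in Set.Ici (1 : ℝ), ENNReal.ofReal (ρ ^ ((d : ℝ) - p))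

lemma J1_lt (d : ℕ) (p : ℝ) (hp : (d : ℝ) + 1 < p) : J1 d p < ⊤ := by
  have := integrableOn_Ioi_rpow_of_lt (a := (d : ℝ) - p) (by linarith) (c := 1) one_pos
  rw [← integrableOn_Ici_iff_integrableOn_Ioi] at this
  exact this.lintegral_lt_top

lemma J1_eq (d : ℕ) (p τ : ℝ) (hp : (d : ℝ) + 1 < p) (hτ : 0 < τ) (hτ1 : τ < 1) :
    ∫⁻ ρ in Set.Ici (1 : ℝ), ENNReal.ofReal ρ * ENNReal.ofReal (Kbar d p τ ρ) = J1 d p := by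
  refine setLIntegral_congr_fun measurableSet_Ici fun ρ hρ => ?_
  have h1 : (1:ℝ) ≤ ρ := hρ
  rw [Kbar_large d p τ ρ hp hτ hτ1 hρ, ← ENNReal.ofReal_mul (by linarith)]
  congr 1
  nth_rewrite 1 [← Real.rpow_one ρ]
  rw [← Real.rpow_add (by linarith)]
  congr 1; ring

lemma Wset_meas (t σ : ℝ) :
    MeasurableSet {x : ℝ × ℝ | 0 < σ * (t - x.1) ∧ σ * (t - x.1) ≤ x.2} := by
  have h0 : Measurable fun x : ℝ × ℝ => σ * (t - x.1) := by fun_prop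
  exact (measurableSet_lt measurable_const h0).inter (measurableSet_le h0 measurable_snd)

lemma W_eq (k : ℝ → ℝ≥0∞) (hk : Measurable k) (R : Set ℝ) (t σ : ℝ)
    (hσ : σ = 1 ∨ σ = -1) :
    ∫⁻ u : ℝ, ∫⁻ ρ in R, {x : ℝ × ℝ | 0 < σ * (t - x.1) ∧ σ * (t - x.1) ≤ x.2}.indicator
      (fun x => k x.2) (u, ρ) = ∫⁻ ρ in R, ENNReal.ofReal ρ * k ρ := by
  rw [lintegral_lintegral_swap]
  · apply lintegral_congr
    intro ρ
    have : ∀ u : ℝ, {x : ℝ × ℝ | 0 < σ * (t - x.1) ∧ σ * (t - x.1) ≤ x.2}.indicator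
      (fun x => k x.2) (u, ρ) = {u : ℝ | 0 < σ * (t - u) ∧ σ * (t - u) ≤ ρ}.indicator
      (fun _ => k ρ) u := fun u => by simp [Set.indicator]
    simp_rw [this]
    have hm : MeasurableSet {u : ℝ | 0 < σ * (t - u) ∧ σ * (t - u) ≤ ρ} := by
      have h0 : Measurable fun u : ℝ => σ * (t - u) := by fun_prop
      exact (measurableSet_lt measurable_const h0).inter (measurableSet_le h0 measurable_const)
    rw [lintegral_indicator_const hm, mul_comm]
    congr 1
    rcases hσ with rfl | rfl
    · have : {u : ℝ | 0 < 1 * (t - u) ∧ 1 * (t - u) ≤ ρ} = Set.Ico (t - ρ) t := by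
        ext u; simp only [Set.mem_ofPred_eq, Set.mem_Ico]
        constructor <;> rintro ⟨h1, h2⟩ <;> constructor <;> linarith
      rw [this]; simp
    · have : {u : ℝ | 0 < -1 * (t - u) ∧ -1 * (t - u) ≤ ρ} = Set.Ioc t (t + ρ) := by
        ext u; simp only [Set.mem_ofPred_eq, Set.mem_Ioc]
        constructor <;> rintro ⟨h1, h2⟩ <;> constructor <;> linarith
      rw [this]; simp
  · apply Measurable.aemeasurable
    apply Measurable.indicator (by fun_prop)
    exact Wset_meas t σ

/-- one-sided interaction -/
def Lam (K : ℝ → ℝ) (f : ℝ → ℝ) (I : Set ℝ) (σ : ℝ) : ℝ≥0∞ :=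
  ∫⁻ u in I, ∫⁻ ρ in Set.Ioi (0 : ℝ), ENNReal.ofReal (|f (u + σ * ρ) - f u| * K ρ)

/-- crossing weight -/
def Tw (K : ℝ → ℝ) (R : Set ℝ) (I : Set ℝ) (t σ : ℝ) : ℝ≥0∞ :=
  ∫⁻ u in I, ∫⁻ ρ in R, {x : ℝ × ℝ | 0 < σ * (t - x.1) ∧ σ * (t - x.1) ≤ x.2}.indicator
      (fun x => ENNReal.ofReal (K x.2)) (u, ρ)

lemma W_meas (k : ℝ → ℝ≥0∞) (hk : Measurable k) (t σ : ℝ) :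
    Measurable ({x : ℝ × ℝ | 0 < σ * (t - x.1) ∧ σ * (t - x.1) ≤ x.2}.indicator
      (fun x => k x.2)) := by
  apply Measurable.indicator (by fun_prop)
  exact Wset_meas t σ

lemma Tw_le (K : ℝ → ℝ) (hK : Measurable K) (R I : Set ℝ) (t σ : ℝ) (hσ : σ = 1 ∨ σ = -1) :
    Tw K R I t σ ≤ ∫⁻ ρ in R, ENNReal.ofReal ρ * ENNReal.ofReal (K ρ) := by
  rw [← W_eq (fun ρ => ENNReal.ofReal (K ρ)) (by fun_prop) R t σ hσ]
  exact setLIntegral_le_lintegral _ _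

lemma Tw_sum_le (K : ℝ → ℝ) (hK : Measurable K) (R : Set ℝ) (t σ : ℝ) (hσ : σ = 1 ∨ σ = -1)
    (N : Finset ℝ) (I : ℝ → Set ℝ) (hI : ∀ s ∈ N, MeasurableSet (I s))
    (hd : (N : Set ℝ).PairwiseDisjoint I) :
    ∑ s ∈ N, Tw K R (I s) t σ ≤ ∫⁻ ρ in R, ENNReal.ofReal ρ * ENNReal.ofReal (K ρ) := by
  have : ∑ s ∈ N, Tw K R (I s) t σ = Tw K R (⋃ s ∈ N, I s) t σ := by
    unfold Tw
    rw [lintegral_biUnion_finset hd hI]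
  rw [this]
  exact Tw_le K hK R _ t σ hσ

lemma ae_shift {S : Set ℝ} (hS : ∀ᵐ x, x ∈ S) (u σ : ℝ) (hσ : σ = 1 ∨ σ = -1) :
    ∀ᵐ ρ : ℝ, u + σ * ρ ∈ S := by
  rcases hσ with rfl | rfl
  · simpa using (measurePreserving_add_left volume u).quasiMeasurePreserving.ae hS
  · simpa [← sub_eq_add_neg] using
      (Measure.measurePreserving_sub_left volume u).quasiMeasurePreserving.ae hS

lemma Lam_le (K : ℝ → ℝ) (hK : Measurable K) (hK0 : ∀ ρ, 0 ≤ K ρ) (f : ℝ → ℝ)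
    (hf1 : ∀ u v, |f u - f v| ≤ 1)
    (I S : Set ℝ) (hI : MeasurableSet I) (hS : ∀ᵐ x, x ∈ S) (s σ : ℝ) (hσ : σ = 1 ∨ σ = -1)
    (hIs : ∀ u ∈ I, 0 < σ * (s - u))
    (h : ∀ u ∈ I, u ∈ S → ∀ v ∈ S, 0 < σ * (v - u) → σ * (v - u) < σ * (s - u) → f u = f v) :
    Lam K f I σ ≤ ∫⁻ ρ in Set.Ioi 0, ENNReal.ofReal ρ * ENNReal.ofReal (K ρ) := by
  refine le_trans ?_ (Tw_le K hK (Set.Ioi 0) I s σ hσ)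
  unfold Lam Tw
  apply lintegral_mono_ae
  filter_upwards [ae_restrict_mem hI, ae_restrict_of_ae hS] with u hu huS
  apply lintegral_mono_ae
  filter_upwards [ae_restrict_mem measurableSet_Ioi, ae_restrict_of_ae (ae_shift hS u σ hσ)]
    with ρ hρ hρS
  have hρ' : 0 < ρ := hρ
  have e : σ * (u + σ * ρ - u) = ρ := by rcases hσ with rfl | rfl <;> ring
  by_cases hc : σ * (s - u) ≤ ρ
  · rw [Set.indicator_of_mem (by exact ⟨hIs u hu, hc⟩)]
    apply ENNReal.ofReal_le_ofReal
    have := hf1 (u + σ * ρ) u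
    nlinarith [hK0 ρ]
  · have := h u hu huS _ hρS (by rw [e]; exact hρ) (by rw [e]; linarith)
    rw [← this]; simp

lemma Lam_compare (K : ℝ → ℝ) (hK : Measurable K) (hK0 : ∀ ρ, 0 ≤ K ρ) (f g : ℝ → ℝ)
    (hf1 : ∀ u v, |f u - f v| ≤ 1) (hg : Measurable g)
    (I I' S : Set ℝ) (hI : MeasurableSet I) (hII : I ⊆ I') (hS : ∀ᵐ x, x ∈ S)
    (σ : ℝ) (hσ : σ = 1 ∨ σ = -1) (A : Finset ℝ)
    (h : ∀ u ∈ I, u ∈ S → ∀ v ∈ S, 0 < σ * (v - u) → |f v - f u| ≠ |g v - g u| →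
      ∃ t ∈ A, 0 < σ * (t - u) ∧ σ * (t - u) ≤ σ * (v - u) ∧ 1 ≤ σ * (v - u)) :
    Lam K f I σ ≤ Lam K g I' σ + ∑ t ∈ A, Tw K (Set.Ici 1) I t σ := by
  have h1 : Lam K g I σ ≤ Lam K g I' σ := lintegral_mono_set hII
  refine le_trans ?_ (add_le_add_left h1 _)
  have hW := fun t => W_meas (fun ρ => ENNReal.ofReal (K ρ)) (by fun_prop) t σ
  unfold Lam Tw
  rw [← lintegral_finsetSum _ (fun t _ => (hW t).lintegral_prod_right'),
    ← lintegral_add_right _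
      (Finset.measurable_sum _ fun t _ => (hW t).lintegral_prod_right')]
  apply lintegral_mono_ae
  filter_upwards [ae_restrict_mem hI, ae_restrict_of_ae hS] with u hu huS
  have hW' : ∀ t, Measurable fun ρ =>
      {x : ℝ × ℝ | 0 < σ * (t - x.1) ∧ σ * (t - x.1) ≤ x.2}.indicator
      (fun x => ENNReal.ofReal (K x.2)) (u, ρ) := fun t => (hW t).comp measurable_prodMk_left
  rw [← lintegral_finsetSum _ (fun t _ => hW' t)]
  have hIci : Set.Ici (1 : ℝ) = Set.Ici 1 ∩ Set.Ioi 0 :=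
    (Set.inter_eq_left.2 (Set.Ici_subset_Ioi.2 one_pos)).symm
  rw [hIci, ← setLIntegral_indicator measurableSet_Ici,
    ← lintegral_add_right _ ((Finset.measurable_sum _ fun t _ => hW' t).indicator measurableSet_Ici)]
  apply lintegral_mono_ae
  filter_upwards [ae_restrict_mem measurableSet_Ioi, ae_restrict_of_ae (ae_shift hS u σ hσ)]
    with ρ hρ hρS
  have hρ' : 0 < ρ := hρ
  have e : σ * (u + σ * ρ - u) = ρ := by rcases hσ with rfl | rfl <;> ring
  by_cases hc : |f (u + σ * ρ) - f u| = |g (u + σ * ρ) - g u|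
  · rw [hc]; exact le_self_add
  · obtain ⟨t, ht, h1, h2, h3⟩ := h u hu huS _ hρS (by rw [e]; exact hρ) hc
    rw [e] at h2 h3
    refine le_trans ?_ le_add_self
    rw [Set.indicator_of_mem (by exact h3)]
    refine le_trans ?_ (Finset.single_le_sum (fun _ _ => zero_le) ht)
    rw [Set.indicator_of_mem (by exact ⟨h1, h2⟩)]
    apply ENNReal.ofReal_le_ofReal
    have := hf1 (u + σ * ρ) u
    nlinarith [hK0 ρ]

lemma Lam_toReal (K : ℝ → ℝ) (hK : Measurable K) (hK0 : ∀ ρ, 0 ≤ K ρ)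
    (hKi : IntegrableOn K (Set.Ioi 0)) (f : ℝ → ℝ) (hf : Measurable f)
    (hf1 : ∀ u v, |f u - f v| ≤ 1) (I : Set ℝ) (σ : ℝ) :
    ∫ u in I, ∫ ρ in Set.Ioi (0 : ℝ), |f (u + σ * ρ) - f u| * K ρ = (Lam K f I σ).toReal := by
  have hm : Measurable fun x : ℝ × ℝ => |f (x.1 + σ * x.2) - f x.1| * K x.2 := by
    have : Measurable fun x : ℝ × ℝ => f (x.1 + σ * x.2) := hf.comp (by fun_prop)
    fun_prop
  have hnn : ∀ u ρ, 0 ≤ |f (u + σ * ρ) - f u| * K ρ :=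
    fun u ρ => mul_nonneg (abs_nonneg _) (hK0 ρ)
  rw [integral_eq_lintegral_of_nonneg_ae]
  · unfold Lam
    congr 1
    apply lintegral_congr
    intro u
    apply ofReal_integral_eq_lintegral_ofReal
    · refine hKi.mono' (hm.comp measurable_prodMk_left).aestronglyMeasurable ?_
      refine Eventually.of_forall fun ρ => ?_
      rw [Real.norm_of_nonneg (hnn u ρ)]
      have := hf1 (u + σ * ρ) u
      nlinarith [hK0 ρ]
    · exact Eventually.of_forall (hnn u)
  · exact Eventually.of_forall fun u => integral_nonneg (hnn u)
  · exact (hm.stronglyMeasurable.integral_prod_right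
      (ν := volume.restrict (Set.Ioi (0:ℝ)))).aestronglyMeasurable

lemma ind_meas {E : Set ℝ} (hE : MeasurableSet E) : Measurable (ind E) :=
  measurable_const.indicator hE

lemma ind_cases (E : Set ℝ) (u : ℝ) : ind E u = 0 ∨ ind E u = 1 := by
  unfold ind
  by_cases h : u ∈ E <;> simp [h]

lemma ind_sub_le (E : Set ℝ) (u v : ℝ) : |ind E u - ind E v| ≤ 1 := by
  rcases ind_cases E u with h | h <;> rcases ind_cases E v with h' | h' <;> simp [h, h']

lemma Csplit (d : ℕ) (hd : 1 ≤ d) (p τ : ℝ) (hp : (d : ℝ) + 1 < p) (hτ : 0 < τ) (hτ1 : τ < 1) :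
    (∫⁻ ρ in Set.Ioi (0:ℝ), ENNReal.ofReal ρ * ENNReal.ofReal (Kbar d p τ ρ)) < ⊤ ∧
    2 * (∫⁻ ρ in Set.Ioi (0:ℝ), ENNReal.ofReal ρ * ENNReal.ofReal (Kbar d p τ ρ)).toReal
      = (∫ ρ in Set.Ioo (-1 : ℝ) 1, |ρ| * Kbar d p τ ρ) + 2 * (J1 d p).toReal := by
  have hint : IntegrableOn (fun ρ => |ρ| * Kbar d p τ ρ) (Set.Ioo (-1) 1) := by
    apply Measure.integrableOn_of_bounded (M := (τ ^ (1 / (p - d - 1))) ^ (-p)) (by simp)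
      (by have := Kbar_meas d p τ; fun_prop :
          Measurable fun ρ => |ρ| * Kbar d p τ ρ).aestronglyMeasurable
    refine (ae_restrict_mem measurableSet_Ioo).mono fun ρ hρ => ?_
    have h1 : |ρ| ≤ 1 := abs_le.2 ⟨hρ.1.le, hρ.2.le⟩
    have h0 := Kbar_nonneg d p τ ρ hτ
    rw [Real.norm_of_nonneg (mul_nonneg (abs_nonneg _) h0)]
    have := Kbar_small d hd p τ ρ hp hτ h1
    nlinarith [abs_nonneg ρ]
  have hs : Set.Ioi (0:ℝ) = Set.Ioo 0 1 ∪ Set.Ici 1 := by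
    rw [Set.Ioo_union_Ici_eq_Ioi one_pos]
  have hdis : Disjoint (Set.Ioo (0:ℝ) 1) (Set.Ici 1) := by
    rw [Set.disjoint_left]; intro x hx hx'; exact absurd hx.2 (not_lt.2 hx')
  have hsm : ∫⁻ ρ in Set.Ioo (0:ℝ) 1, ENNReal.ofReal ρ * ENNReal.ofReal (Kbar d p τ ρ)
      = ENNReal.ofReal (∫ ρ in Set.Ioo (0:ℝ) 1, |ρ| * Kbar d p τ ρ) := by
    rw [ofReal_integral_eq_lintegral_ofReal (hint.mono_set (Set.Ioo_subset_Ioo_left (by simp)))]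
    · refine setLIntegral_congr_fun measurableSet_Ioo fun ρ hρ => ?_
      rw [← ENNReal.ofReal_mul hρ.1.le, abs_of_pos hρ.1]
    · exact Eventually.of_forall fun ρ => mul_nonneg (abs_nonneg _) (Kbar_nonneg d p τ ρ hτ)
  have hC : ∫ ρ in Set.Ioo (-1 : ℝ) 1, |ρ| * Kbar d p τ ρ
      = 2 * ∫ ρ in Set.Ioo (0:ℝ) 1, |ρ| * Kbar d p τ ρ := by
    rw [← integral_Ioc_eq_integral_Ioo, ← integral_Ioc_eq_integral_Ioo,
      ← intervalIntegral.integral_of_le (by norm_num), ← intervalIntegral.integral_of_le (by norm_num)]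
    have hii : IntervalIntegrable (fun ρ => |ρ| * Kbar d p τ ρ) volume (-1) 1 := by
      rw [intervalIntegrable_iff_integrableOn_Ioo_of_le (by norm_num)]; exact hint
    rw [← intervalIntegral.integral_add_adjacent_intervals (b := 0)
      (hii.mono_set (by
        rw [Set.uIcc_of_le (by norm_num), Set.uIcc_of_le (by norm_num)]
        exact Set.Icc_subset_Icc_right (by norm_num)))
      (hii.mono_set (by
        rw [Set.uIcc_of_le (by norm_num), Set.uIcc_of_le (by norm_num)]
        exact Set.Icc_subset_Icc_left (by norm_num)))]
    have := intervalIntegral.integral_comp_neg (a := 0) (b := 1)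
      (fun ρ => |ρ| * Kbar d p τ ρ)
    simp only [abs_neg, Kbar_neg, neg_zero] at this
    rw [← this]; ring
  have hnn : 0 ≤ ∫ ρ in Set.Ioo (0:ℝ) 1, |ρ| * Kbar d p τ ρ :=
    integral_nonneg fun ρ => mul_nonneg (abs_nonneg _) (Kbar_nonneg d p τ ρ hτ)
  rw [hs, lintegral_union measurableSet_Ici hdis, J1_eq d p τ hp hτ hτ1, hsm]
  have hJ := J1_lt d p hp
  refine ⟨ENNReal.add_lt_top.2 ⟨ENNReal.ofReal_lt_top, hJ⟩, ?_⟩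
  rw [ENNReal.toReal_add ENNReal.ofReal_ne_top hJ.ne, ENNReal.toReal_ofReal hnn, hC]
  ring

lemma rPt_eq (d : ℕ) (hd : 1 ≤ d) (p τ : ℝ) (hp : (d : ℝ) + 1 < p) (hτ : 0 < τ) (hτ1 : τ < 1)
    (E B : Set ℝ) (hE : MeasurableSet E) (s : ℝ) :
    rPt d p τ E B s = (∫ ρ in Set.Ioo (-1 : ℝ) 1, |ρ| * Kbar d p τ ρ)
      - (Lam (Kbar d p τ) (ind E) {u : ℝ | predPt B s < (u : EReal) ∧ u < s} 1).toReal
      - (Lam (Kbar d p τ) (ind E) {u : ℝ | s < u ∧ (u : EReal) < succPt B s} (-1)).toReal := by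
  unfold rPt rtauE
  have hK0 := fun ρ => Kbar_nonneg d p τ ρ hτ
  have hKi := Kbar_int d hd p τ hp hτ hτ1
  rw [← Lam_toReal _ (Kbar_meas d p τ) hK0 hKi _ (ind_meas hE) (ind_sub_le E),
    ← Lam_toReal _ (Kbar_meas d p τ) hK0 hKi _ (ind_meas hE) (ind_sub_le E)]
  simp only [one_mul]
  congr 2
  ext u
  have := integral_comp_neg_Ioi (0:ℝ) (fun ρ => |ind E (u + ρ) - ind E u| * Kbar d p τ ρ)
  simp only [neg_zero, Kbar_neg] at this
  rw [← integral_Iic_eq_integral_Iio, ← this]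
  simp only [neg_mul, one_mul]

/-- good points -/
lemma exists_good (E B : Set ℝ) (h : IsOneDPerimeterSet E B) :
    ∃ S : Set ℝ, (∀ᵐ x, x ∈ S) ∧ (∀ x ∈ S, x ∉ B) ∧
      (∀ u ∈ S, ∀ v ∈ S, u < v → (∀ t ∈ B, u < t → v ≤ t) → ind E u = ind E v) ∧
      (∀ u ∈ S, ∀ v ∈ S, ∀ s ∈ B, u < s → s < v → (∀ t ∈ B, u < t → t < v → t = s) →
        ind E u ≠ ind E v) := by
  obtain ⟨hE, hB, hfin, hconst, hjump⟩ := h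
  have hBc : B.Countable := by
    have : B = ⋃ n : ℕ, B ∩ Set.Icc (-(n:ℝ)) n := by
      ext x
      simp only [Set.mem_iUnion, Set.mem_inter_iff, Set.mem_Icc]
      constructor
      · intro hx
        obtain ⟨n, hn⟩ := exists_nat_ge |x|
        exact ⟨n, hx, abs_le.1 hn⟩
      · rintro ⟨n, hx, _⟩; exact hx
    rw [this]
    exact Set.countable_iUnion fun n => (hfin _ isCompact_Icc).countable
  have hB0 : ∀ᵐ x, x ∉ B := hBc.ae_notMem volume
  have key : ∀ q : ℚ × ℚ, ∃ c : ℝ, ((q.1 : ℝ) < q.2 → Set.Ioo (q.1 : ℝ) q.2 ∩ B = ∅ →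
      ∀ᵐ u, u ∈ Set.Ioo (q.1 : ℝ) q.2 → ind E u = c) := by
    intro q
    by_cases hq : (q.1 : ℝ) < q.2 ∧ Set.Ioo (q.1 : ℝ) q.2 ∩ B = ∅
    · obtain ⟨c, hc⟩ := hconst _ _ hq.1 hq.2
      exact ⟨c, fun _ _ => (ae_restrict_iff' measurableSet_Ioo).1 hc⟩
    · exact ⟨0, fun h1 h2 => absurd ⟨h1, h2⟩ hq⟩
  choose c hc using key
  have hall : ∀ᵐ u, ∀ q : ℚ × ℚ, ((q.1 : ℝ) < q.2 → Set.Ioo (q.1 : ℝ) q.2 ∩ B = ∅ →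
      u ∈ Set.Ioo (q.1 : ℝ) q.2 → ind E u = c q) := by
    rw [ae_all_iff]
    intro q
    by_cases hq : (q.1 : ℝ) < q.2 ∧ Set.Ioo (q.1 : ℝ) q.2 ∩ B = ∅
    · filter_upwards [hc q hq.1 hq.2] with u hu _ _ using hu
    · exact Eventually.of_forall fun u h1 h2 => absurd ⟨h1, h2⟩ hq
  set S : Set ℝ := {u | u ∉ B ∧ ∀ q : ℚ × ℚ, ((q.1 : ℝ) < q.2 → Set.Ioo (q.1 : ℝ) q.2 ∩ B = ∅ →
      u ∈ Set.Ioo (q.1 : ℝ) q.2 → ind E u = c q)} with hSdef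
  have hS : ∀ᵐ x, x ∈ S := by filter_upwards [hB0, hall] with x h1 h2 using ⟨h1, h2⟩
  have h3 : ∀ u ∈ S, ∀ v ∈ S, u < v → (∀ t ∈ B, u < t → v ≤ t) → ind E u = ind E v := by
    intro u hu v hv huv hno
    obtain ⟨ε, hε, hεu⟩ := Metric.isOpen_iff.1 hB.isOpen_compl u hu.1
    obtain ⟨δ, hδ, hδv⟩ := Metric.isOpen_iff.1 hB.isOpen_compl v hv.1
    obtain ⟨a, ha1, ha2⟩ := exists_rat_btwn (show u - ε < u by linarith)
    obtain ⟨b, hb1, hb2⟩ := exists_rat_btwn (show v < v + δ by linarith)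
    have hab : ((a, b) : ℚ × ℚ).1 < ((((a, b) : ℚ × ℚ).2 : ℚ) : ℝ) := by
      show (a : ℝ) < b
      linarith
    have hemp : Set.Ioo (((a, b) : ℚ × ℚ).1 : ℝ) ((a, b) : ℚ × ℚ).2 ∩ B = ∅ := by
      rw [Set.eq_empty_iff_forall_notMem]
      rintro t ⟨⟨ht1, ht2⟩, htB⟩
      simp only at ht1 ht2
      rcases le_or_gt t u with h | h
      · refine hεu ?_ htB
        rw [Metric.mem_ball, Real.dist_eq, abs_lt]; constructor <;> linarith
      · have := hno t htB h
        refine hδv ?_ htB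
        rw [Metric.mem_ball, Real.dist_eq, abs_lt]; constructor <;> linarith
    rw [hu.2 (a, b) hab hemp ⟨ha2, huv.trans hb1⟩, hv.2 (a, b) hab hemp ⟨ha2.trans huv, hb1⟩]
  refine ⟨S, hS, fun x hx => hx.1, h3, ?_⟩
  intro u hu v hv s hs hus hsv hno
  apply hjump s hs u v hus hsv
  · rw [Set.eq_empty_iff_forall_notMem]
    rintro t ⟨⟨ht1, ht2⟩, htB⟩
    exact ht2.ne (hno t htB ht1 (ht2.trans hsv))
  · rw [Set.eq_empty_iff_forall_notMem]
    rintro t ⟨⟨ht1, ht2⟩, htB⟩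
    exact ht1.ne' (hno t htB (hus.trans ht1) ht2)
  · filter_upwards [ae_restrict_mem measurableSet_Ioo, ae_restrict_of_ae hS] with w hw hwS
    refine (h3 u hu w hwS hw.1 fun t ht hut => ?_).symm
    by_contra hlt
    push Not at hlt
    have := hno t ht hut (by linarith [hw.2])
    linarith [hw.2]
  · filter_upwards [ae_restrict_mem measurableSet_Ioo, ae_restrict_of_ae hS] with w hw hwS
    refine h3 w hwS v hv hw.2 fun t ht hut => ?_
    by_contra hlt
    push Not at hlt
    have := hno t ht (by linarith [hw.1]) hlt
    linarith [hw.1]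

lemma exists_mem_of_ae {S : Set ℝ} (hS : ∀ᵐ x, x ∈ S) {a b : ℝ} (hab : a < b) :
    ∃ x ∈ S, a < x ∧ x < b := by
  obtain ⟨x, hx, hxS⟩ := (Measure.dense_of_ae hS).exists_mem_open isOpen_Ioo (Set.nonempty_Ioo.2 hab)
  exact ⟨x, hx, hxS⟩

lemma parity (E B F BF A SE SF : Set ℝ) (hBE : IsOneDPerimeterSet E B)
    (hBF : BF = B \ A) (hSE : ∀ᵐ x, x ∈ SE) (hSF : ∀ᵐ x, x ∈ SF)
    (hE1 : ∀ u ∈ SE, ∀ v ∈ SE, u < v → (∀ t ∈ B, u < t → v ≤ t) → ind E u = ind E v)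
    (hE2 : ∀ u ∈ SE, ∀ v ∈ SE, ∀ s ∈ B, u < s → s < v → (∀ t ∈ B, u < t → t < v → t = s) →
        ind E u ≠ ind E v)
    (hF1 : ∀ u ∈ SF, ∀ v ∈ SF, u < v → (∀ t ∈ BF, u < t → v ≤ t) → ind F u = ind F v)
    (hF2 : ∀ u ∈ SF, ∀ v ∈ SF, ∀ s ∈ BF, u < s → s < v → (∀ t ∈ BF, u < t → t < v → t = s) →
        ind F u ≠ ind F v) :
    ∀ n : ℕ, ∀ u ∈ SE ∩ SF, ∀ v ∈ SE ∩ SF, u < v → (∀ t ∈ A, u < t → v ≤ t) →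
      (B ∩ Set.Ioo u v).ncard = n → |ind E u - ind F u| = |ind E v - ind F v| := by
  intro n
  induction n using Nat.strong_induction_on with
  | _ n ih =>
  intro u hu v hv huv hA hn
  have hfin : (B ∩ Set.Ioo u v).Finite :=
    (hBE.2.2.1 _ (isCompact_Icc (a := u) (b := v))).subset
      (Set.inter_subset_inter_right _ Set.Ioo_subset_Icc_self)
  by_cases hemp : ∃ s ∈ B, u < s ∧ s < v
  · obtain ⟨s, hs, hus, hsv⟩ := hemp
    have hsF : s ∈ BF := by
      rw [hBF]; exact ⟨hs, fun h => absurd (hA s h hus) (not_le.2 hsv)⟩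
    -- isolate `s`
    have hcl : IsClosed ((B ∩ Set.Ioo u v) \ {s}) := (hfin.subset Set.sdiff_subset).isClosed
    obtain ⟨ε, hε, hεs⟩ := Metric.isOpen_iff.1 hcl.isOpen_compl s (by simp)
    have hS : ∀ᵐ x, x ∈ SE ∩ SF := by filter_upwards [hSE, hSF] with x h1 h2 using ⟨h1, h2⟩
    obtain ⟨a, haS, ha1, ha2⟩ := exists_mem_of_ae hS (show max u (s - ε) < s by
      apply max_lt hus; linarith)
    obtain ⟨b, hbS, hb1, hb2⟩ := exists_mem_of_ae hS (show s < min v (s + ε) by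
      apply lt_min hsv; linarith)
    rw [max_lt_iff] at ha1
    rw [lt_min_iff] at hb2
    have hiso : ∀ t ∈ B, a < t → t < b → t = s := by
      intro t ht h1 h2
      by_contra hne
      refine hεs (a := t) ?_ ⟨⟨ht, by linarith [ha1.1], by linarith [hb2.1]⟩, hne⟩
      rw [Metric.mem_ball, Real.dist_eq, abs_lt]; constructor <;> linarith [ha1.2, hb2.2]
    have c1 : (B ∩ Set.Ioo u a).ncard < n := by
      rw [← hn]
      refine Set.ncard_lt_ncard ⟨Set.inter_subset_inter_right _
        (Set.Ioo_subset_Ioo_right (by linarith)), fun h => ?_⟩ hfin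
      have := (h (⟨hs, hus, hsv⟩ : s ∈ B ∩ Set.Ioo u v)).2.2
      linarith
    have c2 : (B ∩ Set.Ioo b v).ncard < n := by
      rw [← hn]
      refine Set.ncard_lt_ncard ⟨Set.inter_subset_inter_right _
        (Set.Ioo_subset_Ioo_left (by linarith)), fun h => ?_⟩ hfin
      have := (h (⟨hs, hus, hsv⟩ : s ∈ B ∩ Set.Ioo u v)).2.1
      linarith
    have e1 := ih _ c1 u hu a haS ha1.1 (fun t ht h => by linarith [hA t ht h, ha2]) rfl
    have e2 := ih _ c2 b hbS v hv hb2.1 (fun t ht h => hA t ht (by linarith)) rfl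
    have n1 := hE2 a haS.1 b hbS.1 s hs ha2 hb1 hiso
    have n2 := hF2 a haS.2 b hbS.2 s hsF ha2 hb1 (fun t ht => hiso t (by rw [hBF] at ht; exact ht.1))
    rw [e1, ← e2]
    rcases ind_cases E a with h1 | h1 <;> rcases ind_cases E b with h2 | h2 <;>
      rcases ind_cases F a with h3 | h3 <;> rcases ind_cases F b with h4 | h4 <;>
      simp [h1, h2, h3, h4] at n1 n2 ⊢
  · push Not at hemp
    rw [hE1 u hu.1 v hv.1 huv hemp, hF1 u hu.2 v hv.2 huv (fun t ht => hemp t (by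
      rw [hBF] at ht; exact ht.1))]

lemma lt_of_predPt {B : Set ℝ} {s t u : ℝ} (ht : t ∈ B) (hts : t < s)
    (hu : predPt B s < (u : EReal)) : t < u := by
  have : (t : EReal) ≤ predPt B s := le_sSup ⟨t, ⟨ht, hts⟩, rfl⟩
  exact_mod_cast this.trans_lt hu

lemma lt_of_succPt {B : Set ℝ} {s t u : ℝ} (ht : t ∈ B) (hts : s < t)
    (hu : (u : EReal) < succPt B s) : u < t := by
  have : succPt B s ≤ (t : EReal) := sInf_le ⟨t, ⟨ht, hts⟩, rfl⟩
  exact_mod_cast hu.trans_le this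

lemma predPt_mono {B B' : Set ℝ} (h : B' ⊆ B) (s : ℝ) : predPt B' s ≤ predPt B s :=
  sSup_le_sSup (Set.image_mono fun _ ht => ⟨h ht.1, ht.2⟩)

lemma succPt_anti {B B' : Set ℝ} (h : B' ⊆ B) (s : ℝ) : succPt B s ≤ succPt B' s :=
  sInf_le_sInf (Set.image_mono fun _ ht => ⟨h ht.1, ht.2⟩)

/-- left and right gaps -/
def gap (B : Set ℝ) (σ s : ℝ) : Set ℝ :=
  {u : ℝ | (σ = 1 ∧ predPt B s < (u : EReal) ∧ u < s) ∨
    (σ = -1 ∧ s < u ∧ (u : EReal) < succPt B s)}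

lemma gap_one (B : Set ℝ) (s : ℝ) :
    gap B 1 s = {u : ℝ | predPt B s < (u : EReal) ∧ u < s} := by
  ext u; simp [gap]; norm_num

lemma gap_neg_one (B : Set ℝ) (s : ℝ) :
    gap B (-1) s = {u : ℝ | s < u ∧ (u : EReal) < succPt B s} := by
  ext u; simp [gap]; norm_num

lemma gap_meas (B : Set ℝ) (σ s : ℝ) (hσ : σ = 1 ∨ σ = -1) : MeasurableSet (gap B σ s) := by
  rcases hσ with rfl | rfl
  · rw [gap_one]
    exact (measurableSet_lt measurable_const measurable_coe_real_ereal).inter measurableSet_Iio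
  · rw [gap_neg_one]
    exact measurableSet_Ioi.inter (measurableSet_lt measurable_coe_real_ereal measurable_const)

lemma gap_mono {B B' : Set ℝ} (h : B' ⊆ B) (σ s : ℝ) : gap B σ s ⊆ gap B' σ s := by
  rintro u (⟨h1, h2, h3⟩ | ⟨h1, h2, h3⟩)
  · exact Or.inl ⟨h1, (predPt_mono h s).trans_lt h2, h3⟩
  · exact Or.inr ⟨h1, h2, h3.trans_le (succPt_anti h s)⟩

lemma gap_pos {B : Set ℝ} {σ s u : ℝ} (hu : u ∈ gap B σ s) : 0 < σ * (s - u) := by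
  rcases hu with ⟨rfl, h2, h3⟩ | ⟨rfl, h2, h3⟩ <;> linarith

/-- beyond `u` in direction `σ`, there is no point of `B` before `s` -/
lemma gap_le {B : Set ℝ} {σ s u t : ℝ} (hu : u ∈ gap B σ s) (ht : t ∈ B)
    (h : 0 ≤ σ * (t - u)) : σ * (s - u) ≤ σ * (t - u) := by
  rcases hu with ⟨rfl, h2, h3⟩ | ⟨rfl, h2, h3⟩
  · by_contra hc
    have := lt_of_predPt ht (by linarith) h2
    linarith
  · by_contra hc
    have := lt_of_succPt ht (by linarith) h3
    linarith

lemma gap_disj {B : Set ℝ} {σ s s' : ℝ} (hs : s ∈ B) (hs' : s' ∈ B) (hne : s ≠ s') :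
    Disjoint (gap B σ s) (gap B σ s') := by
  rw [Set.disjoint_left]
  intro u h1 h2
  have a1 := gap_le h1 hs' (gap_pos h2).le
  have a2 := gap_le h2 hs (gap_pos h1).le
  apply hne
  rcases h1 with ⟨rfl, _⟩ | ⟨rfl, _⟩ <;> linarith

lemma far {B : Set ℝ} {s t σ : ℝ} (hσ : σ = 1 ∨ σ = -1)
    (h : ¬ min ((s : EReal) - predPt B s) (succPt B s - (s : EReal)) < ((1 : ℝ) : EReal))
    (ht : t ∈ B) (hst : 0 < σ * (t - s)) : 1 ≤ σ * (t - s) := by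
  rw [not_lt, le_min_iff] at h
  rcases hσ with rfl | rfl
  · have : succPt B s ≤ (t : EReal) := sInf_le ⟨t, ⟨ht, by linarith⟩, rfl⟩
    have := h.2.trans (EReal.sub_le_sub this le_rfl)
    rw [← EReal.coe_sub, EReal.coe_le_coe_iff] at this
    linarith
  · have : (t : EReal) ≤ predPt B s := le_sSup ⟨t, ⟨ht, by linarith⟩, rfl⟩
    have := h.1.trans (EReal.sub_le_sub le_rfl this)
    rw [← EReal.coe_sub, EReal.coe_le_coe_iff] at this
    linarith

lemma gap_bound (K : ℝ → ℝ) (hK : Measurable K) (hK0 : ∀ ρ, 0 ≤ K ρ)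
    (E B S : Set ℝ) (hS : ∀ᵐ x, x ∈ S)
    (hE1 : ∀ u ∈ S, ∀ v ∈ S, u < v → (∀ t ∈ B, u < t → v ≤ t) → ind E u = ind E v)
    (s σ : ℝ) (hσ : σ = 1 ∨ σ = -1) :
    Lam K (ind E) (gap B σ s) σ
      ≤ ∫⁻ ρ in Set.Ioi 0, ENNReal.ofReal ρ * ENNReal.ofReal (K ρ) := by
  refine Lam_le K hK hK0 _ (ind_sub_le E) _ S (gap_meas B σ s hσ) hS s σ hσ
    (fun u hu => gap_pos hu) ?_
  intro u hu huS v hvS h1 h2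
  rcases hσ with rfl | rfl
  · refine hE1 u huS v hvS (by linarith) fun t ht hut => ?_
    have := gap_le hu ht (by linarith)
    linarith
  · refine (hE1 v hvS u huS (by linarith) fun t ht hut => ?_).symm
    by_contra hc
    have := gap_le hu ht (by linarith)
    linarith

lemma gap_compare (K : ℝ → ℝ) (hK : Measurable K) (hK0 : ∀ ρ, 0 ≤ K ρ)
    (E B F BF S : Set ℝ) (A : Finset ℝ) (hF : MeasurableSet F) (hS : ∀ᵐ x, x ∈ S)
    (hAB : (A : Set ℝ) ⊆ B) (hBF : BF = B \ A)
    (hpar : ∀ u ∈ S, ∀ v ∈ S, u < v → (∀ t ∈ A, u < t → v ≤ t) →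
      |ind E u - ind F u| = |ind E v - ind F v|) (hSA : ∀ x ∈ S, x ∉ B)
    (s σ : ℝ) (hσ : σ = 1 ∨ σ = -1) (hs : s ∈ BF)
    (hfar : ∀ t ∈ B, 0 < σ * (t - s) → 1 ≤ σ * (t - s)) :
    Lam K (ind E) (gap B σ s) σ ≤ Lam K (ind F) (gap BF σ s) σ
      + ∑ t ∈ A, Tw K (Set.Ici 1) (gap B σ s) t σ := by
  refine Lam_compare K hK hK0 _ _ (ind_sub_le E) (ind_meas hF) _ _ S (gap_meas B σ s hσ)
    (gap_mono (by rw [hBF]; exact Set.sdiff_subset) σ s) hS σ hσ A ?_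
  intro u hu huS v hvS huv hne
  have hne' : |ind E u - ind F u| ≠ |ind E v - ind F v| := by
    intro he
    apply hne
    rcases ind_cases E u with h1 | h1 <;> rcases ind_cases E v with h2 | h2 <;>
      rcases ind_cases F u with h3 | h3 <;> rcases ind_cases F v with h4 | h4 <;>
      simp [h1, h2, h3, h4] at he ⊢
  have hex : ∃ t ∈ A, 0 < σ * (t - u) ∧ σ * (t - u) ≤ σ * (v - u) := by
    by_contra hc
    push Not at hc
    apply hne'
    rcases hσ with rfl | rfl
    · refine hpar u huS v hvS (by linarith) fun t ht hut => ?_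
      have := hc t ht (by linarith)
      linarith
    · refine (hpar v hvS u huS (by linarith) fun t ht hut => ?_).symm
      by_contra hlt
      have := hc t ht (by linarith)
      linarith
  obtain ⟨t, ht, h1, h2⟩ := hex
  refine ⟨t, ht, h1, h2, ?_⟩
  have g1 := gap_le hu (hAB ht) h1.le
  have g2 := gap_pos hu
  have hst : s ≠ t := by
    rintro rfl
    rw [hBF] at hs
    exact hs.2 ht
  have := hfar t (hAB ht) (by
    rcases hσ with rfl | rfl
    · have := lt_of_le_of_ne (show s ≤ t by linarith) hst
      linarith
    · have := lt_of_le_of_ne (show t ≤ s by linarith) hst.symm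
      linarith)
  rcases hσ with rfl | rfl <;> linarith

lemma main_ineq (d : ℕ) (hd : 1 ≤ d) (p τ : ℝ) (hp : (d : ℝ) + 1 < p) (hτ : 0 < τ)
    (hτ1 : τ < 1) (h : ℝ) (E B : Set ℝ) (hE : IsOneDPerimeterSet E B)
    (A : Set ℝ) (hA : A ⊆ B ∩ Set.Ico 0 h) (F BF : Set ℝ) (hF : IsOneDPerimeterSet F BF)
    (hBF : BF = B \ A)
    (hfar : ∀ s ∈ B ∩ Set.Ico 0 h, s ∉ A →
      ¬ min ((s : EReal) - predPt B s) (succPt B s - (s : EReal)) < ((1 : ℝ) : EReal)) :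
    (∑ᶠ s ∈ BF ∩ Set.Ico 0 h, rPt d p τ F BF s)
      ≤ (∑ᶠ s ∈ B ∩ Set.Ico 0 h, rPt d p τ E B s)
        + (4 * (J1 d p).toReal + 1) * (A.ncard : ℝ) := by
  have hfin : (B ∩ Set.Ico 0 h).Finite := (hE.2.2.1 _ (isCompact_Icc (a := 0) (b := h))).subset
    (Set.inter_subset_inter_right _ Set.Ico_subset_Icc_self)
  have hAfin : A.Finite := hfin.subset hA
  have hNfin : (BF ∩ Set.Ico 0 h).Finite := hfin.subset
    (by rw [hBF]; exact Set.inter_subset_inter_left _ Set.sdiff_subset)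
  lift A to Finset ℝ using hAfin
  set N := hNfin.toFinset with hN
  have hNmem : ∀ s, s ∈ N ↔ s ∈ BF ∩ Set.Ico 0 h := fun s => by simp [hN]
  have hunion : B ∩ Set.Ico 0 h = ((N ∪ A : Finset ℝ) : Set ℝ) := by
    ext s
    simp only [Finset.coe_union, Set.mem_union, Finset.mem_coe, hNmem, hBF]
    constructor
    · intro hs
      by_cases hsA : s ∈ A
      · exact Or.inr hsA
      · exact Or.inl ⟨⟨hs.1, hsA⟩, hs.2⟩
    · rintro (hs | hs)
      · exact ⟨hs.1.1, hs.2⟩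
      · exact hA hs
  have hdisj : Disjoint N A := by
    rw [Finset.disjoint_left]
    intro s hs hsA
    rw [hNmem, hBF] at hs
    exact hs.1.2 hsA
  have hNcoe : BF ∩ Set.Ico 0 h = (N : Set ℝ) := by simp [hN]
  rw [hunion, hNcoe, finsum_mem_coe_finset, finsum_mem_coe_finset, Finset.sum_union hdisj,
    Set.ncard_coe_finset]
  obtain ⟨SE, hSE, hSEB, hE1, hE2⟩ := exists_good E B hE
  obtain ⟨SF, hSF, hSFB, hF1, hF2⟩ := exists_good F BF hF
  have hpar := parity E B F BF A SE SF hE hBF hSE hSF hE1 hE2 hF1 hF2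
  have hS : ∀ᵐ x, x ∈ SE ∩ SF := by filter_upwards [hSE, hSF] with x h1 h2 using ⟨h1, h2⟩
  obtain ⟨hJt, hJ⟩ := Csplit d hd p τ hp hτ hτ1
  have hK := Kbar_meas d p τ
  have hK0 := fun ρ => Kbar_nonneg d p τ ρ hτ
  have hJ1 := J1_lt d p hp
  set K := Kbar d p τ with hKdef
  set J := ∫⁻ ρ in Set.Ioi (0:ℝ), ENNReal.ofReal ρ * ENNReal.ofReal (K ρ) with hJdef
  set C := ∫ ρ in Set.Ioo (-1 : ℝ) 1, |ρ| * K ρ with hCdef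
  have rE : ∀ s, rPt d p τ E B s = C - (Lam K (ind E) (gap B 1 s) 1).toReal
      - (Lam K (ind E) (gap B (-1) s) (-1)).toReal := fun s => by
    rw [gap_one, gap_neg_one, rPt_eq d hd p τ hp hτ hτ1 E B hE.1]
  have rF : ∀ s, rPt d p τ F BF s = C - (Lam K (ind F) (gap BF 1 s) 1).toReal
      - (Lam K (ind F) (gap BF (-1) s) (-1)).toReal := fun s => by
    rw [gap_one, gap_neg_one, rPt_eq d hd p τ hp hτ hτ1 F BF hF.1]
  -- removed points
  have bE : ∀ s σ : ℝ, σ = 1 ∨ σ = -1 → (Lam K (ind E) (gap B σ s) σ).toReal ≤ J.toReal :=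
    fun s σ hσ => ENNReal.toReal_mono hJt.ne (gap_bound K hK hK0 E B SE hSE hE1 s σ hσ)
  have hrem : -(2 * (J1 d p).toReal) * (A.card : ℝ) ≤ ∑ s ∈ A, rPt d p τ E B s := by
    have : ∑ s ∈ A, (-(2 * (J1 d p).toReal)) ≤ ∑ s ∈ A, rPt d p τ E B s := by
      apply Finset.sum_le_sum
      intro s _
      rw [rE s]
      have := bE s 1 (Or.inl rfl)
      have := bE s (-1) (Or.inr rfl)
      linarith
    rw [Finset.sum_const, nsmul_eq_mul] at this
    linarith
  -- kept points
  have hTt : ∀ s t σ : ℝ, σ = 1 ∨ σ = -1 → Tw K (Set.Ici 1) (gap B σ s) t σ ≠ ⊤ := by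
    intro s t σ hσ
    refine ((Tw_le K hK _ _ t σ hσ).trans_lt ?_).ne
    rw [J1_eq d p τ hp hτ hτ1]; exact hJ1
  have hcmp : ∀ s ∈ N, ∀ σ : ℝ, σ = 1 ∨ σ = -1 →
      (Lam K (ind E) (gap B σ s) σ).toReal ≤ (Lam K (ind F) (gap BF σ s) σ).toReal
        + ∑ t ∈ A, (Tw K (Set.Ici 1) (gap B σ s) t σ).toReal := by
    intro s hs σ hσ
    rw [hNmem] at hs
    have hsB : s ∈ B ∧ s ∉ A := by
      have := hs.1; rw [hBF] at this; exact this
    have hFt : Lam K (ind F) (gap BF σ s) σ ≠ ⊤ :=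
      ((gap_bound K hK hK0 F BF SF hSF hF1 s σ hσ).trans_lt hJt).ne
    have hsum : ∑ t ∈ A, Tw K (Set.Ici 1) (gap B σ s) t σ ≠ ⊤ :=
      ENNReal.sum_ne_top.2 fun t _ => hTt s t σ hσ
    rw [← ENNReal.toReal_sum fun t _ => hTt s t σ hσ, ← ENNReal.toReal_add hFt hsum]
    refine ENNReal.toReal_mono (ENNReal.add_ne_top.2 ⟨hFt, hsum⟩) ?_
    exact gap_compare K hK hK0 E B F BF (SE ∩ SF) A hF.1 hS (fun t ht => (hA ht).1) hBF
      (fun u hu v hv huv hAt => hpar _ u hu v hv huv hAt rfl) (fun x hx => hSEB x hx.1)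
      s σ hσ hs.1 (fun t ht hst => far hσ (hfar s ⟨hsB.1, hs.2⟩ hsB.2) ht hst)
  have hTsum : ∀ σ : ℝ, σ = 1 ∨ σ = -1 →
      ∑ s ∈ N, ∑ t ∈ A, (Tw K (Set.Ici 1) (gap B σ s) t σ).toReal
        ≤ (J1 d p).toReal * (A.card : ℝ) := by
    intro σ hσ
    rw [Finset.sum_comm]
    have : ∑ t ∈ A, ∑ s ∈ N, (Tw K (Set.Ici 1) (gap B σ s) t σ).toReal
        ≤ ∑ t ∈ A, (J1 d p).toReal := by
      apply Finset.sum_le_sum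
      intro t _
      rw [← ENNReal.toReal_sum fun s _ => hTt s t σ hσ]
      refine ENNReal.toReal_mono hJ1.ne ?_
      rw [← J1_eq d p τ hp hτ hτ1]
      refine Tw_sum_le K hK _ t σ hσ N (fun s => gap B σ s) (fun s _ => gap_meas B σ s hσ) ?_
      intro s hs s' hs' hne
      have m1 := ((hNmem s).1 hs).1
      have m2 := ((hNmem s').1 hs').1
      rw [hBF] at m1 m2
      exact gap_disj m1.1 m2.1 hne
    rw [Finset.sum_const, nsmul_eq_mul] at this
    linarith
  have hkeep : ∑ s ∈ N, rPt d p τ F BF s ≤ ∑ s ∈ N, rPt d p τ E B s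
      + 2 * (J1 d p).toReal * (A.card : ℝ) := by
    have : ∑ s ∈ N, rPt d p τ F BF s ≤ ∑ s ∈ N, (rPt d p τ E B s
        + ∑ t ∈ A, (Tw K (Set.Ici 1) (gap B 1 s) t 1).toReal
        + ∑ t ∈ A, (Tw K (Set.Ici 1) (gap B (-1) s) t (-1)).toReal) := by
      apply Finset.sum_le_sum
      intro s hs
      rw [rE s, rF s]
      have := hcmp s hs 1 (Or.inl rfl)
      have := hcmp s hs (-1) (Or.inr rfl)
      linarith
    rw [Finset.sum_add_distrib, Finset.sum_add_distrib] at this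
    have := hTsum 1 (Or.inl rfl)
    have := hTsum (-1) (Or.inr rfl)
    linarith
  have hc0 : (0 : ℝ) ≤ A.card := Nat.cast_nonneg _
  linarith

/-- Replacement lemma: removing boundary points (including all the ones at small mutual
distance) increases the one-dimensional energy at most by a constant per removed point. -/
theorem statement9 (d : ℕ) (hd : 1 ≤ d) (p : ℝ) (hp : (d : ℝ) + 1 < p) :
    ∃ η₀ τ₀ M₀ : ℝ, 0 < η₀ ∧ 0 < τ₀ ∧ 0 < M₀ ∧
      ∀ τ : ℝ, 0 < τ → τ < τ₀ → ∀ h : ℝ, 0 < h →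
        ∀ E B : Set ℝ, IsOneDPerimeterSet E B →
        ∀ A₀ : Set ℝ, A₀ ⊆ B ∩ Set.Ico 0 h →
        ∀ A₁ : Set ℝ,
          A₁ = {s | s ∈ B ∩ Set.Ico 0 h ∧
            min ((s : EReal) - predPt B s) (succPt B s - (s : EReal)) < (η₀ : ℝ)} →
        ∀ F BF : Set ℝ, IsOneDPerimeterSet F BF → BF = B \ (A₀ ∪ A₁) →
          (∑ᶠ s ∈ BF ∩ Set.Ico 0 h, rPt d p τ F BF s)
            ≤ (∑ᶠ s ∈ B ∩ Set.Ico 0 h, rPt d p τ E B s)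
              + M₀ * ((A₀ ∪ A₁).ncard : ℝ) := by
  have hJ := J1_lt d p hp
  refine ⟨1, 1, 4 * (J1 d p).toReal + 1, one_pos, one_pos, by positivity, ?_⟩
  intro τ hτ hτ1 h hh E B hE A₀ hA₀ A₁ hA₁ F BF hF hBF
  exact main_ineq d hd p τ hp hτ hτ1 h E B hE (A₀ ∪ A₁) (by
    apply Set.union_subset hA₀
    rw [hA₁]; exact fun s hs => hs.1) F BF hF hBF (by
    intro s hs hsA hlt
    apply hsA
    right
    rw [hA₁]
    exact ⟨hs, hlt⟩)

end
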